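/- arXiv:2004.08905 — 2 statements merged into one kernel-verified Lean document; each statement's English description precedes it below -/
import Mathlib

section
/- (Asymptotics of the linear frequencies.) Write ω_j(κ) = √κ·|j|^{3/2} + c_j(κ)/(√κ·|j|^{1/2}), i.e. define c_j(κ) := √κ·|j|^{1/2}·(ω_j(κ) − √κ·|j|^{3/2}), so that c_j(κ)/√κ = (ω_j(κ) − √κ·|j|^{3/2})·|j|^{1/2}. Then for every n ∈ ℕ₀ there exists a constant C(n, 𝚑) > 0 such that for all j ∈ ℤ \ {0} and all κ ∈ [κ₁, κ₂], the n-th derivative in κ satisfies |∂_κ^n ( (ω_j(κ) − √κ·|j|^{3/2})·|j|^{1/2} )| ≤ C(n, 𝚑). -/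
open Real Finset Set

/-- `G_j := j · tanh(dpt · j)` (finite depth `dpt`). -/
noncomputable def Gfun (dpt : ℝ) (j : ℤ) : ℝ := (j : ℝ) * Real.tanh (dpt * (j : ℝ))

/-- The linear frequencies `ω_j(κ)`. -/
noncomputable def omegaF (dpt g γ : ℝ) (j : ℤ) (κ : ℝ) : ℝ :=
  Real.sqrt (κ * Gfun dpt j * (j : ℝ) ^ 2 + g * Gfun dpt j + (γ * Gfun dpt j / (2 * (j : ℝ))) ^ 2)

/-- The linear frequencies `Ω_j(κ) = ω_j(κ) + (γ/2) G_j / j`. -/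
noncomputable def OmegaF (dpt g γ : ℝ) (j : ℤ) (κ : ℝ) : ℝ :=
  omegaF dpt g γ j κ + γ / 2 * Gfun dpt j / (j : ℝ)

theorem sq_mul_one_sub_tanh_le_one {x : ℝ} (hx : 0 ≤ x) : x ^ 2 * (1 - Real.tanh x) ≤ 1 := by
  have hprod : Real.exp x * Real.exp (-x) = 1 := by rw [← Real.exp_add]; simp
  have hquad := Real.quadratic_le_exp_of_nonneg (x := 2 * x) (by positivity)
  rw [two_mul x, Real.exp_add] at hquad
  have hneg := Real.exp_pos (-x)
  have hbound : 2 * x ^ 2 * Real.exp (-x) ≤ Real.exp x := by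
    calc 2 * x ^ 2 * Real.exp (-x) ≤ Real.exp x * Real.exp x * Real.exp (-x) := by
          refine mul_le_mul_of_nonneg_right ?_ hneg.le
          nlinarith
      _ = Real.exp x := by rw [mul_assoc, hprod, mul_one]
  have htanh : 1 - Real.tanh x = 2 * Real.exp (-x) / (Real.exp x + Real.exp (-x)) := by
    rw [Real.tanh_eq]; field_simp; ring
  rw [htanh, ← mul_div_assoc, div_le_one (by positivity)]
  linarith

theorem tanh_pos_of_pos {x : ℝ} (hx : 0 < x) : 0 < Real.tanh x := by
  rw [Real.tanh_eq_sinh_div_cosh]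
  exact div_pos (Real.sinh_pos_iff.2 hx) (Real.cosh_pos x)

theorem analyticAt_iteratedDeriv_sqrt (n : ℕ) {x : ℝ} (hx : 0 < x) :
    AnalyticAt ℝ (iteratedDeriv n Real.sqrt) x := by
  rw [iteratedDeriv_eq_iterate]
  exact (Real.contDiffAt_sqrt hx.ne').analyticAt.iterated_deriv n

theorem exists_bound_iteratedDeriv_sqrt (n : ℕ) {a : ℝ} (ha : 0 < a) (b : ℝ) :
    ∃ M > 0, ∀ x ∈ Set.Icc a b, |iteratedDeriv n Real.sqrt x| ≤ M := by
  obtain ⟨M, hM⟩ := (isCompact_Icc (a := a) (b := b)).exists_bound_of_continuousOn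
    (f := iteratedDeriv n Real.sqrt) fun x hx =>
      (analyticAt_iteratedDeriv_sqrt n (ha.trans_le hx.1)).continuousAt.continuousWithinAt
  exact ⟨max M 1, by positivity, fun x hx => (hM x hx).trans (le_max_left _ _)⟩

theorem Gfun_eq_abs_mul_tanh (dpt : ℝ) (j : ℤ) :
    Gfun dpt j = |(j : ℝ)| * Real.tanh (dpt * |(j : ℝ)|) := by
  rcases abs_cases (j : ℝ) with ⟨h, -⟩ | ⟨h, -⟩ <;> rw [h, Gfun]
  rw [mul_neg, Real.tanh_neg, neg_mul_neg]

/-- The shift of the surface tension in `ω_j(κ) = |j|^(3/2) √t √(κ + s)`, `t = tanh (dpt |j|)`. -/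
noncomputable def tensionShift (dpt g γ : ℝ) (j : ℤ) : ℝ :=
  g / |(j : ℝ)| ^ 2 + γ ^ 2 * Real.tanh (dpt * |(j : ℝ)|) / (4 * |(j : ℝ)| ^ 3)

theorem omegaF_eq {dpt : ℝ} (g γ : ℝ) (hdpt : 0 < dpt) {j : ℤ} (hj : j ≠ 0) (κ : ℝ) :
    omegaF dpt g γ j κ = |(j : ℝ)| ^ ((3 : ℝ) / 2) *
      (Real.sqrt (Real.tanh (dpt * |(j : ℝ)|)) * Real.sqrt (κ + tensionShift dpt g γ j)) := by
  have ha : 0 < |(j : ℝ)| := abs_pos.2 (Int.cast_ne_zero.2 hj)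
  have ht := tanh_pos_of_pos (mul_pos hdpt ha)
  have hpow : |(j : ℝ)| ^ ((3 : ℝ) / 2) = Real.sqrt (|(j : ℝ)| ^ 3) := by
    rw [Real.sqrt_eq_rpow, ← Real.rpow_natCast, ← Real.rpow_mul ha.le]; norm_num
  rw [hpow, ← Real.sqrt_mul ht.le, ← Real.sqrt_mul (by positivity), omegaF, tensionShift,
    Gfun_eq_abs_mul_tanh, div_pow, mul_pow 2 (j : ℝ), ← sq_abs (j : ℝ)]
  congr 1
  field_simp
  ring

theorem tensionShift_nonneg {dpt g : ℝ} (γ : ℝ) (hdpt : 0 < dpt) (hg : 0 < g) {j : ℤ}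
    (hj : j ≠ 0) : 0 ≤ tensionShift dpt g γ j := by
  have ha : 0 < |(j : ℝ)| := abs_pos.2 (Int.cast_ne_zero.2 hj)
  have ht := tanh_pos_of_pos (mul_pos hdpt ha)
  unfold tensionShift
  positivity

theorem one_le_abs_intCast {j : ℤ} (hj : j ≠ 0) : 1 ≤ |(j : ℝ)| := by
  exact_mod_cast Int.one_le_abs hj

theorem sq_mul_tensionShift_le (dpt g γ : ℝ) {j : ℤ} (hj : j ≠ 0) :
    |(j : ℝ)| ^ 2 * tensionShift dpt g γ j ≤ g + γ ^ 2 := by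
  have ha := one_le_abs_intCast hj
  have ha0 : 0 < |(j : ℝ)| := by linarith
  have ht := (Real.tanh_lt_one (dpt * |(j : ℝ)|)).le
  have hsplit : |(j : ℝ)| ^ 2 * tensionShift dpt g γ j =
      g + γ ^ 2 * Real.tanh (dpt * |(j : ℝ)|) / (4 * |(j : ℝ)|) := by
    unfold tensionShift; field_simp
  rw [hsplit]
  gcongr
  rw [div_le_iff₀ (by positivity)]
  gcongr
  linarith

theorem sq_mul_abs_sqrt_tanh_sub_one_le {dpt : ℝ} (hdpt : 0 < dpt) {a : ℝ} (ha : 0 < a) :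
    a ^ 2 * |Real.sqrt (Real.tanh (dpt * a)) - 1| ≤ 1 / dpt ^ 2 := by
  have ht := tanh_pos_of_pos (mul_pos hdpt ha)
  have ht1 := (Real.tanh_lt_one (dpt * a)).le
  have hle : |Real.sqrt (Real.tanh (dpt * a)) - 1| ≤ 1 - Real.tanh (dpt * a) := by
    rw [abs_of_nonpos (by simpa using ht1)]
    have : Real.tanh (dpt * a) ≤ Real.sqrt (Real.tanh (dpt * a)) :=
      Real.le_sqrt_of_sq_le (by nlinarith)
    linarith
  have hdecay := sq_mul_one_sub_tanh_le_one (mul_pos hdpt ha).le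
  rw [le_div_iff₀ (by positivity)]
  calc a ^ 2 * |Real.sqrt (Real.tanh (dpt * a)) - 1| * dpt ^ 2
      ≤ a ^ 2 * (1 - Real.tanh (dpt * a)) * dpt ^ 2 := by gcongr
    _ = (dpt * a) ^ 2 * (1 - Real.tanh (dpt * a)) := by ring
    _ ≤ 1 := hdecay

theorem iteratedDeriv_omegaF_sub {dpt g : ℝ} (γ : ℝ) (hdpt : 0 < dpt) (hg : 0 < g) {j : ℤ}
    (hj : j ≠ 0) (n : ℕ) {κ : ℝ} (hκ : 0 < κ) :
    iteratedDeriv n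
      (fun κ' => (omegaF dpt g γ j κ' - Real.sqrt κ' * |(j : ℝ)| ^ ((3 : ℝ) / 2))
        * |(j : ℝ)| ^ ((1 : ℝ) / 2)) κ =
      |(j : ℝ)| ^ 2 * (Real.sqrt (Real.tanh (dpt * |(j : ℝ)|)) *
        iteratedDeriv n Real.sqrt (κ + tensionShift dpt g γ j) - iteratedDeriv n Real.sqrt κ) := by
  have ha : 0 < |(j : ℝ)| := abs_pos.2 (Int.cast_ne_zero.2 hj)
  have hs := tensionShift_nonneg γ hdpt hg hj
  have hpow : |(j : ℝ)| ^ ((3 : ℝ) / 2) * |(j : ℝ)| ^ ((1 : ℝ) / 2) = |(j : ℝ)| ^ 2 := by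
    rw [← Real.rpow_add ha, ← Real.rpow_natCast]; norm_num
  have hfun : (fun κ' => (omegaF dpt g γ j κ' - Real.sqrt κ' * |(j : ℝ)| ^ ((3 : ℝ) / 2))
      * |(j : ℝ)| ^ ((1 : ℝ) / 2)) = fun κ' => |(j : ℝ)| ^ 2 *
        (Real.sqrt (Real.tanh (dpt * |(j : ℝ)|)) * Real.sqrt (κ' + tensionShift dpt g γ j)
          - Real.sqrt κ') := by
    funext κ'
    rw [omegaF_eq g γ hdpt hj, ← hpow]
    ring
  have hshift : ContDiffAt ℝ n (fun κ' => Real.sqrt (κ' + tensionShift dpt g γ j)) κ :=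
    ContDiffAt.sqrt (by fun_prop) (by positivity)
  rw [hfun, iteratedDeriv_const_mul_field, iteratedDeriv_fun_sub (contDiffAt_const.mul hshift)
    (Real.contDiffAt_sqrt hκ.ne'), iteratedDeriv_const_mul_field, iteratedDeriv_comp_add_const]

/-- Asymptotics of the linear frequencies: all κ-derivatives of
c_j(κ)/√κ = (ω_j(κ) − √κ·|j|^(3/2))·|j|^(1/2) are bounded uniformly in j ≠ 0
and κ ∈ [κ₁, κ₂]. -/
theorem frequency_asymptotics
    (dpt g γ κ₁ κ₂ : ℝ) (hdpt : 0 < dpt) (hg : 0 < g) (hκ₁ : 0 < κ₁) (hκ₁₂ : κ₁ < κ₂) :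
    ∀ n : ℕ, ∃ C > 0, ∀ j : ℤ, j ≠ 0 → ∀ κ ∈ Set.Icc κ₁ κ₂,
      |iteratedDeriv n
        (fun κ' => (omegaF dpt g γ j κ' - Real.sqrt κ' * |(j : ℝ)| ^ ((3 : ℝ) / 2))
          * |(j : ℝ)| ^ ((1 : ℝ) / 2)) κ| ≤ C := by
  intro n
  obtain ⟨M, hM, hbound⟩ := exists_bound_iteratedDeriv_sqrt n hκ₁ (κ₂ + (g + γ ^ 2))
  obtain ⟨L, hL, hlip⟩ := exists_bound_iteratedDeriv_sqrt (n + 1) hκ₁ (κ₂ + (g + γ ^ 2))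
  refine ⟨1 / dpt ^ 2 * M + L * (g + γ ^ 2), by positivity, fun j hj κ hκ => ?_⟩
  rw [iteratedDeriv_omegaF_sub γ hdpt hg hj n (hκ₁.trans_le hκ.1)]
  have ha := one_le_abs_intCast hj
  have hs := tensionShift_nonneg γ hdpt hg hj
  have hs_le := sq_mul_tensionShift_le dpt g γ hj
  have hamp := sq_mul_abs_sqrt_tanh_sub_one_le hdpt (zero_lt_one.trans_le ha)
  set a := |(j : ℝ)|
  set s := tensionShift dpt g γ j
  set r := Real.sqrt (Real.tanh (dpt * a))
  set φ := iteratedDeriv n Real.sqrt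
  have hs_bound : s ≤ g + γ ^ 2 :=
    (le_mul_of_one_le_left hs (one_le_pow₀ ha)).trans hs_le
  have hκ_mem : κ ∈ Set.Icc κ₁ (κ₂ + (g + γ ^ 2)) := ⟨hκ.1, by nlinarith [hκ.2]⟩
  have hκs_mem : κ + s ∈ Set.Icc κ₁ (κ₂ + (g + γ ^ 2)) :=
    ⟨by linarith [hκ.1], by linarith [hκ.2]⟩
  have hdiff : |φ (κ + s) - φ κ| ≤ L * s := by
    have := (convex_Icc κ₁ (κ₂ + (g + γ ^ 2))).norm_image_sub_le_of_norm_deriv_le (f := φ) (C := L)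
      (fun x hx => (analyticAt_iteratedDeriv_sqrt n (hκ₁.trans_le hx.1)).differentiableAt)
      (fun x hx => by rw [← iteratedDeriv_succ]; exact hlip x hx) hκ_mem hκs_mem
    simpa [abs_of_nonneg hs] using this
  calc |a ^ 2 * (r * φ (κ + s) - φ κ)|
      = |a ^ 2 * (r - 1) * φ (κ + s) + a ^ 2 * (φ (κ + s) - φ κ)| := by congr 1; ring
    _ ≤ |a ^ 2 * (r - 1) * φ (κ + s)| + |a ^ 2 * (φ (κ + s) - φ κ)| := abs_add_le _ _
    _ = a ^ 2 * |r - 1| * |φ (κ + s)| + a ^ 2 * |φ (κ + s) - φ κ| := by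
        simp only [abs_mul, abs_of_nonneg (sq_nonneg a)]
    _ ≤ 1 / dpt ^ 2 * M + a ^ 2 * (L * s) := by
        gcongr
        exact hbound _ hκs_mem
    _ = 1 / dpt ^ 2 * M + L * (a ^ 2 * s) := by ring
    _ ≤ 1 / dpt ^ 2 * M + L * (g + γ ^ 2) := by gcongr
end

section
/- (Transversality, zeroth Melnikov.) There exist m₀ ∈ ℕ and ρ₀ > 0 such that for every κ ∈ [κ₁, κ₂] and every ℓ ∈ ℤ^ν \ {0}: max over 0 ≤ n ≤ m₀ of |∂_κ^n ( Ω⃗(κ)·ℓ )| ≥ ρ₀·⟨ℓ⟩. -/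
open Real Finset Set

/-- `sinh x / x` is monotone on the positive reals, in product form. -/
lemma Real.mul_sinh_le_mul_sinh {x y : ℝ} (hx : 0 < x) (hxy : x ≤ y) :
    y * Real.sinh x ≤ x * Real.sinh y := by
  have hconv : ConvexOn ℝ (Set.Ici 0) Real.sinh := by
    refine MonotoneOn.convexOn_of_deriv (convex_Ici 0) Real.continuous_sinh.continuousOn
      Real.differentiable_sinh.differentiableOn ?_
    rw [Real.deriv_sinh, interior_Ici]
    intro a ha b hb hab
    rw [Real.cosh_le_cosh, abs_of_pos ha, abs_of_pos hb]
    exact hab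
  have hy : 0 < y := hx.trans_le hxy
  have h := hconv.2 (Set.mem_Ici.2 hy.le) (Set.mem_Ici.2 le_rfl) (div_nonneg hx.le hy.le)
    (sub_nonneg.2 ((div_le_one hy).2 hxy)) (by ring)
  simp only [smul_eq_mul, mul_zero, add_zero, Real.sinh_zero, div_mul_cancel₀ _ hy.ne'] at h
  calc y * Real.sinh x ≤ y * (x / y * Real.sinh y) := by gcongr
    _ = x * Real.sinh y := by field_simp

/-- `tanh x / x` is antitone on the positive reals, in product form. -/
lemma Real.mul_tanh_le_mul_tanh {x y : ℝ} (hx : 0 < x) (hxy : x ≤ y) :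
    x * Real.tanh y ≤ y * Real.tanh x := by
  rcases hxy.eq_or_lt with rfl | hlt
  · rfl
  have h := Real.mul_sinh_le_mul_sinh (x := y - x) (y := y + x) (by linarith) (by linarith)
  rw [Real.sinh_add, Real.sinh_sub] at h
  rw [Real.tanh_eq_sinh_div_cosh, Real.tanh_eq_sinh_div_cosh, mul_div_assoc', mul_div_assoc',
    div_le_div_iff₀ (Real.cosh_pos y) (Real.cosh_pos x)]
  linarith

/-- If `D (n + 1)` is the derivative of `D n` on an open set for all `n`, then the `D n` are the
iterated derivatives of any function agreeing with `D 0` there. -/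
lemma iteratedDeriv_eq_of_hasDerivAt {f : ℝ → ℝ} {D : ℕ → ℝ → ℝ} {s : Set ℝ} (hs : IsOpen s)
    (h0 : ∀ x ∈ s, f x = D 0 x) (hD : ∀ n, ∀ x ∈ s, HasDerivAt (D n) (D (n + 1) x) x)
    (n : ℕ) : ∀ x ∈ s, iteratedDeriv n f x = D n x := by
  induction n with
  | zero => simpa using h0
  | succ n ih =>
    intro x hx
    rw [iteratedDeriv_succ]
    have : iteratedDeriv n f =ᶠ[nhds x] D n := by
      filter_upwards [hs.mem_nhds hx] with y hy using ih y hy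
    rw [this.deriv_eq, (hD n x hx).deriv]

lemma hasDerivAt_div_pow_mul_sqrt {A B x : ℝ} (h : 0 < A * x + B) (n : ℕ) :
    HasDerivAt (fun y => (A / (A * y + B)) ^ n * √(A * y + B))
      ((1 / 2 - n) * ((A / (A * x + B)) ^ (n + 1) * √(A * x + B))) x := by
  have hlin : HasDerivAt (fun y => A * y + B) A x := by
    simpa using ((hasDerivAt_id x).const_mul A).add_const B
  have hsq := hlin.sqrt h.ne'
  have hq : HasDerivAt (fun y => A / (A * y + B)) (-(A / (A * x + B)) ^ 2) x := by
    have h0 := (hasDerivAt_const x A).div hlin h.ne'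
    have e : (0 * (A * x + B) - A * A) / (A * x + B) ^ 2 = -(A / (A * x + B)) ^ 2 := by
      field_simp
      ring
    rwa [e] at h0
  have hs : √(A * x + B) ≠ 0 := (Real.sqrt_pos.2 h).ne'
  have e : A / (2 * √(A * x + B)) = A / (A * x + B) * √(A * x + B) / 2 := by
    field_simp
    rw [Real.sq_sqrt h.le]
  rw [e] at hsq
  refine ((hq.fun_pow n).fun_mul hsq).congr_deriv ?_
  rcases n with _ | n
  · simp; ring
  · push_cast
    ring

/-- The falling factorial `(1/2) (1/2 - 1) ⋯ (1/2 - n + 1)`. -/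
noncomputable def halfFalling (n : ℕ) : ℝ := ∏ i ∈ Finset.range n, (1 / 2 - (i : ℝ))

lemma halfFalling_ne_zero (n : ℕ) : halfFalling n ≠ 0 := by
  refine Finset.prod_ne_zero_iff.2 fun i _ h => ?_
  have h2 : (1 : ℝ) = 2 * i := by linarith
  have h3 : 1 = 2 * i := by exact_mod_cast h2
  omega

lemma iteratedDeriv_sum_sqrt {ι : Type*} [Fintype ι] (A B C v : ι → ℝ) {s : Set ℝ}
    (hs : IsOpen s) (hpos : ∀ x ∈ s, ∀ a, 0 < A a * x + B a) (n : ℕ) {x : ℝ} (hx : x ∈ s) :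
    iteratedDeriv (n + 1) (fun y => ∑ a, v a * (√(A a * y + B a) + C a)) x =
      halfFalling (n + 1) *
        ∑ a, v a * ((A a / (A a * x + B a)) ^ (n + 1) * √(A a * x + B a)) := by
  have key := iteratedDeriv_eq_of_hasDerivAt (f := fun y => ∑ a, v a * (√(A a * y + B a) + C a))
    (D := fun n y => halfFalling n *
      (∑ a, v a * ((A a / (A a * y + B a)) ^ n * √(A a * y + B a)))
        + if n = 0 then ∑ a, v a * C a else 0) hs ?_ ?_ (n + 1) x hx
  · simpa using key
  · intro y _
    simp [halfFalling, mul_add, Finset.sum_add_distrib]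
  · intro n y hy
    have h := ((HasDerivAt.fun_sum fun a (_ : a ∈ Finset.univ) =>
      (hasDerivAt_div_pow_mul_sqrt (hpos y hy a) n).const_mul (v a)).const_mul
        (halfFalling n)).add_const (if n = 0 then ∑ a, v a * C a else 0)
    refine h.congr_deriv ?_
    simp only [Nat.add_eq_zero_iff, one_ne_zero, and_false, if_false, add_zero, halfFalling,
      Finset.prod_range_succ, Finset.mul_sum]
    exact Finset.sum_congr rfl fun a _ => by ring

/-- A continuous family of injective linear maps on a compact set is uniformly bounded below. -/
lemma exists_pos_forall_mul_norm_le_of_mulVec {n : Type*} [Fintype n] {K : Set ℝ}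
    (hK : IsCompact K) {M : ℝ → Matrix n n ℝ} (hM : ContinuousOn M K)
    (hinj : ∀ x ∈ K, ∀ v, (M x).mulVec v = 0 → v = 0) :
    ∃ ρ > (0 : ℝ), ∀ x ∈ K, ∀ v, ρ * ‖v‖ ≤ ‖(M x).mulVec v‖ := by
  have hcomp : IsCompact (K ×ˢ Metric.sphere (0 : n → ℝ) 1) := hK.prod (isCompact_sphere _ _)
  have hcont : ContinuousOn (fun p : ℝ × (n → ℝ) => ‖(M p.1).mulVec p.2‖)
      (K ×ˢ Metric.sphere (0 : n → ℝ) 1) := by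
    refine ContinuousOn.norm (continuousOn_pi.2 fun i => ?_)
    simp only [Matrix.mulVec, dotProduct]
    refine continuousOn_finsetSum _ fun j _ => ContinuousOn.mul ?_ (by fun_prop)
    have h := continuousOn_pi.1 (continuousOn_pi.1 hM i) j
    exact h.comp continuousOn_fst fun p hp => hp.1
  have hpos : ∀ p ∈ K ×ˢ Metric.sphere (0 : n → ℝ) 1, 0 < ‖(M p.1).mulVec p.2‖ := by
    rintro ⟨x, v⟩ ⟨hx, hv⟩
    refine norm_pos_iff.2 fun h => ?_
    have := hinj x hx v h
    simp [this] at hv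
  obtain ⟨ρ, hρ, hle⟩ := hcomp.exists_forall_le' hcont hpos
  refine ⟨ρ, hρ, fun x hx v => ?_⟩
  rcases eq_or_ne v 0 with rfl | hv
  · simp
  have hv' : 0 < ‖v‖ := norm_pos_iff.2 hv
  have h := hle (x, ‖v‖⁻¹ • v) ⟨hx, by simp [norm_smul, hv'.ne']⟩
  simp only [Matrix.mulVec_smul, norm_smul, norm_inv, norm_norm] at h
  rwa [inv_mul_eq_div, le_div_iff₀ hv'] at h

lemma eq_zero_of_sum_pow_succ_mul_eq_zero {ν : ℕ} {l s v : Fin ν → ℝ}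
    (hl : Function.Injective l) (hl0 : ∀ a, l a ≠ 0) (hs : ∀ a, s a ≠ 0)
    (h : ∀ i : Fin ν, ∑ a, v a * (l a ^ (i.1 + 1) * s a) = 0) : v = 0 := by
  have := Matrix.eq_zero_of_forall_pow_sum_mul_pow_eq_zero (v := fun a => v a * l a * s a) hl ?_
  · funext a
    have := congrFun this a
    simpa [hl0, hs] using this
  · intro i
    rw [← h i]
    exact Finset.sum_congr rfl fun a _ => by ring

lemma Gfun_abs (dpt : ℝ) (j : ℤ) : Gfun dpt |j| = Gfun dpt j := by
  rcases abs_choice j with h | h <;> simp [h, Gfun]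

lemma Gfun_pos {dpt : ℝ} (hdpt : 0 < dpt) {j : ℤ} (hj : j ≠ 0) : 0 < Gfun dpt j := by
  rw [← Gfun_abs]
  have h : (0 : ℝ) < (|j| : ℤ) := by exact_mod_cast abs_pos.2 hj
  refine mul_pos h ?_
  rw [Real.tanh_eq_sinh_div_cosh]
  exact div_pos (Real.sinh_pos_iff.2 (mul_pos hdpt h)) (Real.cosh_pos _)

/-- `G_j / j²` is nonincreasing in `j > 0`. -/
lemma Gfun_mul_sq_le {dpt : ℝ} (hdpt : 0 < dpt) {j k : ℤ} (hj : 0 < j) (hjk : j ≤ k) :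
    Gfun dpt k * (j : ℝ) ^ 2 ≤ Gfun dpt j * (k : ℝ) ^ 2 := by
  have hj' : (0 : ℝ) < j := by exact_mod_cast hj
  have hjk' : (j : ℝ) ≤ k := by exact_mod_cast hjk
  have hk' : (0 : ℝ) < k := hj'.trans_le hjk'
  have h := Real.mul_tanh_le_mul_tanh (mul_pos hdpt hj') (mul_le_mul_of_nonneg_left hjk' hdpt.le)
  rw [mul_assoc, mul_assoc] at h
  have h' := mul_le_mul_of_nonneg_right (le_of_mul_le_mul_left h hdpt) (mul_pos hj' hk').le
  unfold Gfun
  linarith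

/-- The ratio of the constant and linear coefficients of `ω_j(κ)²`. -/
noncomputable def freqRatio (dpt g γ : ℝ) (j : ℤ) : ℝ :=
  (g * Gfun dpt j + (γ * Gfun dpt j / (2 * (j : ℝ))) ^ 2) / (Gfun dpt j * (j : ℝ) ^ 2)

lemma freqRatio_eq {dpt : ℝ} (g γ : ℝ) (hdpt : 0 < dpt) {j : ℤ} (hj : j ≠ 0) :
    freqRatio dpt g γ j =
      g / (j : ℝ) ^ 2 + γ ^ 2 / 4 * (Gfun dpt j / (j : ℝ) ^ 2) / (j : ℝ) ^ 2 := by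
  have hG := (Gfun_pos hdpt hj).ne'
  have hj' : (j : ℝ) ≠ 0 := by exact_mod_cast hj
  unfold freqRatio
  field_simp
  ring

lemma freqRatio_lt {dpt g : ℝ} (γ : ℝ) (hdpt : 0 < dpt) (hg : 0 < g) {j k : ℤ} (hj : j ≠ 0)
    (hk : k ≠ 0) (hjk : |j| < |k|) : freqRatio dpt g γ k < freqRatio dpt g γ j := by
  have hj' : (0 : ℝ) < (j : ℝ) ^ 2 := by positivity
  have hk' : (0 : ℝ) < (k : ℝ) ^ 2 := by positivity
  have hsq : (j : ℝ) ^ 2 < (k : ℝ) ^ 2 := by exact_mod_cast sq_lt_sq.2 hjk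
  have hG : Gfun dpt k / (k : ℝ) ^ 2 ≤ Gfun dpt j / (j : ℝ) ^ 2 := by
    rw [div_le_div_iff₀ hk' hj']
    simpa [Gfun_abs] using Gfun_mul_sq_le hdpt (abs_pos.2 hj) hjk.le
  have hGj := Gfun_pos hdpt hj
  rw [freqRatio_eq g γ hdpt hj, freqRatio_eq g γ hdpt hk]
  refine add_lt_add_of_lt_of_le (div_lt_div_of_pos_left hg hj' hsq) ?_
  gcongr

/-- Transversality, zeroth Melnikov conditions. -/
theorem transversality_0th_Melnikov
    (dpt g γ κ₁ κ₂ : ℝ) (hdpt : 0 < dpt) (hg : 0 < g) (hκ₁ : 0 < κ₁) (hκ₁₂ : κ₁ < κ₂)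
    (ν : ℕ) (hν : 1 ≤ ν) (jbar : Fin ν → ℤ)
    (hjne : ∀ a, jbar a ≠ 0)
    (hjinj : Function.Injective fun a => |jbar a|) :
    ∃ m₀ : ℕ, ∃ ρ₀ > (0 : ℝ), ∀ κ ∈ Set.Icc κ₁ κ₂, ∀ ℓ : Fin ν → ℤ, ℓ ≠ 0 →
      ∃ n ≤ m₀, ρ₀ * max 1 ‖ℓ‖ ≤
        |iteratedDeriv n (fun κ' => ∑ a, (ℓ a : ℝ) * OmegaF dpt g γ (jbar a) κ') κ| := by
  set A : Fin ν → ℝ := fun a => Gfun dpt (jbar a) * (jbar a : ℝ) ^ 2 with hA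
  set B : Fin ν → ℝ := fun a =>
    g * Gfun dpt (jbar a) + (γ * Gfun dpt (jbar a) / (2 * (jbar a : ℝ))) ^ 2 with hB
  set C : Fin ν → ℝ := fun a => γ / 2 * Gfun dpt (jbar a) / (jbar a : ℝ) with hC
  have hApos : ∀ a, 0 < A a := fun a => by
    have := Gfun_pos hdpt (hjne a)
    have : (jbar a : ℝ) ≠ 0 := by exact_mod_cast hjne a
    positivity
  have hBpos : ∀ a, 0 < B a := fun a => by
    have := Gfun_pos hdpt (hjne a)
    positivity
  have hpos : ∀ x ∈ Set.Ioi (0 : ℝ), ∀ a, 0 < A a * x + B a := fun x hx a =>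
    add_pos (mul_pos (hApos a) hx) (hBpos a)
  have hinj : ∀ x ∈ Set.Ioi (0 : ℝ), Function.Injective fun a => A a / (A a * x + B a) := by
    intro x hx a b hab
    by_contra hne
    have hr : freqRatio dpt g γ (jbar a) = freqRatio dpt g γ (jbar b) := by
      have h1 := hApos a
      have h2 := hApos b
      change B a / A a = B b / A b
      rw [div_eq_div_iff (hpos x hx a).ne' (hpos x hx b).ne'] at hab
      rw [div_eq_div_iff h1.ne' h2.ne']
      linarith
    rcases lt_or_gt_of_ne (hjinj.ne hne) with h | h
    · exact (freqRatio_lt γ hdpt hg (hjne a) (hjne b) h).ne' hr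
    · exact (freqRatio_lt γ hdpt hg (hjne b) (hjne a) h).ne hr
  have hIcc : Set.Icc κ₁ κ₂ ⊆ Set.Ioi 0 := fun x hx => hκ₁.trans_le hx.1
  let M : ℝ → Matrix (Fin ν) (Fin ν) ℝ := fun x i a => halfFalling (i.1 + 1) *
    ((A a / (A a * x + B a)) ^ (i.1 + 1) * √(A a * x + B a))
  have hMv : ∀ x v i, (M x).mulVec v i = halfFalling (i.1 + 1) *
      ∑ a, v a * ((A a / (A a * x + B a)) ^ (i.1 + 1) * √(A a * x + B a)) := by
    intro x v i
    simp only [M, Matrix.mulVec, dotProduct, Finset.mul_sum]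
    exact Finset.sum_congr rfl fun a _ => by ring
  have hMcont : ContinuousOn M (Set.Icc κ₁ κ₂) := by
    refine continuousOn_pi.2 fun i => continuousOn_pi.2 fun a => ?_
    have hne : ∀ x ∈ Set.Icc κ₁ κ₂, A a * x + B a ≠ 0 := fun x hx => (hpos x (hIcc hx) a).ne'
    fun_prop (disch := assumption)
  obtain ⟨ρ, hρ, hle⟩ := exists_pos_forall_mul_norm_le_of_mulVec isCompact_Icc hMcont
    fun x hx v hv => eq_zero_of_sum_pow_succ_mul_eq_zero (hinj x (hIcc hx))
      (fun a => (div_pos (hApos a) (hpos x (hIcc hx) a)).ne')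
      (fun a => (Real.sqrt_pos.2 (hpos x (hIcc hx) a)).ne')
      fun i => by simpa [hMv, halfFalling_ne_zero] using congrFun hv i
  refine ⟨ν, ρ, hρ, fun κ hκ ℓ hℓ => ?_⟩
  have hfun : (fun κ' => ∑ a, (ℓ a : ℝ) * OmegaF dpt g γ (jbar a) κ') =
      fun y => ∑ a, (ℓ a : ℝ) * (√(A a * y + B a) + C a) := by
    funext y
    refine Finset.sum_congr rfl fun a _ => ?_
    simp only [OmegaF, omegaF, hA, hB, hC]
    congr 3
    ring
  have hnorm : ‖fun a => (ℓ a : ℝ)‖ = ‖ℓ‖ := by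
    simp only [Pi.norm_def]
    congr 2
  have hone : 1 ≤ ‖ℓ‖ := by
    obtain ⟨a, ha⟩ := Function.ne_iff.1 hℓ
    refine le_trans ?_ (norm_le_pi_norm ℓ a)
    rw [Int.norm_eq_abs]
    exact_mod_cast Int.one_le_abs ha
  have : Nonempty (Fin ν) := ⟨⟨0, hν⟩⟩
  obtain ⟨i, hi⟩ := Finite.exists_max fun i => ‖(M κ).mulVec (fun a => (ℓ a : ℝ)) i‖
  refine ⟨i.1 + 1, i.2, ?_⟩
  rw [hfun, iteratedDeriv_sum_sqrt A B C _ isOpen_Ioi hpos i.1 (hIcc hκ), ← hMv,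
    max_eq_right hone, ← hnorm, ← Real.norm_eq_abs]
  exact (hle κ hκ _).trans ((pi_norm_le_iff_of_nonneg (norm_nonneg _)).2 hi)
end
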